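/- Let H be a real number with 1/2 < H < 1, let τ, λ ∈ ℝ and ε > 0, and set s₁ = (τ+λ+ε)/√2. Then ∫_{s₁}^{s₁+ε/√2} ( ∫_{s−√2(τ+ε)}^{−s+√2(λ+ε)} ∫_{s−√2(τ+ε)}^{−s+√2(λ+ε)} |y−ỹ|^{2H−2} · (s + y − √2·λ)^H · (s + ỹ − √2·λ)^H dỹ dy ) ds ≤ 2^{2H−1/2} · ε^{4H+1} / ( (2H+1) · H · (2H−1) ). -/

import Mathlib

open MeasureTheory

/-- Monotonicity of the interval integral for nonnegative integrands, where only the larger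
function has to be integrable. -/
lemma intervalIntegral_mono_of_nonneg {a b : ℝ} {f g : ℝ → ℝ} (hab : a ≤ b)
    (hf : ∀ x ∈ Set.Ioc a b, 0 ≤ f x) (hfg : ∀ x ∈ Set.Ioc a b, f x ≤ g x)
    (hg : IntervalIntegrable g volume a b) :
    ∫ x in a..b, f x ≤ ∫ x in a..b, g x := by
  rw [intervalIntegral.integral_of_le hab, intervalIntegral.integral_of_le hab]
  refine integral_mono_of_nonneg ?_ ((intervalIntegrable_iff_integrableOn_Ioc_of_le hab).1 hg) ?_
  · filter_upwards [ae_restrict_mem measurableSet_Ioc] with x hx using hf x hx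
  · filter_upwards [ae_restrict_mem measurableSet_Ioc] with x hx using hfg x hx

lemma intervalIntegral_nonneg_of_Ioc {a b : ℝ} {f : ℝ → ℝ} (hab : a ≤ b)
    (hf : ∀ x ∈ Set.Ioc a b, 0 ≤ f x) : 0 ≤ ∫ x in a..b, f x := by
  rw [intervalIntegral.integral_of_le hab]
  exact setIntegral_nonneg measurableSet_Ioc hf

lemma intervalIntegrable_abs_rpow_zero_left {p c : ℝ} (hp : -1 < p) (hc : 0 ≤ c) :
    IntervalIntegrable (fun x : ℝ => |x| ^ p) volume 0 c := by
  refine (intervalIntegral.intervalIntegrable_rpow' hp).congr fun x hx => ?_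
  rw [Set.uIoc_of_le hc] at hx
  simp only [abs_of_pos hx.1]

lemma integral_abs_rpow_zero_left {p c : ℝ} (hp : -1 < p) (hc : 0 ≤ c) :
    ∫ x in (0 : ℝ)..c, |x| ^ p = c ^ (p + 1) / (p + 1) := by
  have h : ∫ x in (0 : ℝ)..c, |x| ^ p = ∫ x in (0 : ℝ)..c, x ^ p := by
    refine intervalIntegral.integral_congr fun x hx => ?_
    rw [Set.uIcc_of_le hc] at hx
    simp only [abs_of_nonneg hx.1]
  rw [h, integral_rpow (Or.inl hp), Real.zero_rpow (by linarith), sub_zero]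

lemma intervalIntegrable_abs_rpow_zero_right {p c : ℝ} (hp : -1 < p) (hc : 0 ≤ c) :
    IntervalIntegrable (fun x : ℝ => |x| ^ p) volume (-c) 0 := by
  have h := (intervalIntegrable_abs_rpow_zero_left hp hc).comp_sub_left 0
  simpa using h.symm

lemma integral_abs_rpow_zero_right {p c : ℝ} (hp : -1 < p) (hc : 0 ≤ c) :
    ∫ x in (-c)..(0 : ℝ), |x| ^ p = c ^ (p + 1) / (p + 1) := by
  have h := intervalIntegral.integral_comp_neg (a := 0) (b := c) (fun x : ℝ => |x| ^ p)
  simp only [abs_neg, neg_zero] at h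
  rw [← h, integral_abs_rpow_zero_left hp hc]

lemma intervalIntegrable_abs_sub_rpow {p a b y : ℝ} (hp : -1 < p) (hay : a ≤ y) (hyb : y ≤ b) :
    IntervalIntegrable (fun z : ℝ => |y - z| ^ p) volume a b := by
  have h := ((intervalIntegrable_abs_rpow_zero_right hp (sub_nonneg.2 hyb)).trans
    (intervalIntegrable_abs_rpow_zero_left hp (sub_nonneg.2 hay))).comp_sub_left y
  simpa using h.symm

lemma integral_abs_sub_rpow {p a b y : ℝ} (hp : -1 < p) (hay : a ≤ y) (hyb : y ≤ b) :
    ∫ z in a..b, |y - z| ^ p = ((b - y) ^ (p + 1) + (y - a) ^ (p + 1)) / (p + 1) := by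
  rw [intervalIntegral.integral_comp_sub_left (fun x : ℝ => |x| ^ p) y,
    ← neg_sub b y, ← intervalIntegral.integral_add_adjacent_intervals
      (intervalIntegrable_abs_rpow_zero_right hp (sub_nonneg.2 hyb))
      (intervalIntegrable_abs_rpow_zero_left hp (sub_nonneg.2 hay)),
    integral_abs_rpow_zero_right hp (sub_nonneg.2 hyb),
    integral_abs_rpow_zero_left hp (sub_nonneg.2 hay), add_div]

lemma integral_sub_rpow_add_sub_rpow {q a b : ℝ} (hq : 0 ≤ q) :
    ∫ y in a..b, ((b - y) ^ q + (y - a) ^ q) = 2 * (b - a) ^ (q + 1) / (q + 1) := by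
  have hc : Continuous fun x : ℝ => x ^ q := Real.continuous_rpow_const hq
  have h₁ : Continuous fun y : ℝ => (b - y) ^ q := hc.comp (continuous_const.sub continuous_id)
  have h₂ : Continuous fun y : ℝ => (y - a) ^ q := hc.comp (continuous_id.sub continuous_const)
  rw [intervalIntegral.integral_add (h₁.intervalIntegrable _ _) (h₂.intervalIntegrable _ _),
    intervalIntegral.integral_comp_sub_left (fun x : ℝ => x ^ q) b,
    intervalIntegral.integral_comp_sub_right (fun x : ℝ => x ^ q) a,
    sub_self, sub_self, integral_rpow (Or.inl (by linarith)), Real.zero_rpow (by linarith)]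
  ring

/-- The double integral of `|y - z| ^ (2H - 2)` against a weight with values in `[0, M]`. -/
lemma integral_integral_abs_sub_rpow_mul_le {H a b M : ℝ} {w : ℝ → ℝ} (hH : 1 / 2 < H)
    (hab : a ≤ b) (hw₀ : ∀ y ∈ Set.Ioc a b, 0 ≤ w y) (hw : ∀ y ∈ Set.Ioc a b, w y ≤ M) :
    ∫ y in a..b, ∫ z in a..b, |y - z| ^ (2 * H - 2) * w y * w z ≤
      M ^ 2 / (H * (2 * H - 1)) * (b - a) ^ (2 * H) := by
  have hp : -1 < 2 * H - 2 := by linarith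
  have hq : 0 ≤ 2 * H - 1 := by linarith
  have hpq : 2 * H - 2 + 1 = 2 * H - 1 := by ring
  have hnn : ∀ y ∈ Set.Ioc a b, ∀ z ∈ Set.Ioc a b, 0 ≤ |y - z| ^ (2 * H - 2) * w y * w z :=
    fun y hy z hz => mul_nonneg (mul_nonneg (by positivity) (hw₀ y hy)) (hw₀ z hz)
  have hc : Continuous fun x : ℝ => x ^ (2 * H - 1) := Real.continuous_rpow_const hq
  calc ∫ y in a..b, ∫ z in a..b, |y - z| ^ (2 * H - 2) * w y * w z
      ≤ ∫ y in a..b, M ^ 2 / (2 * H - 1) *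
          ((b - y) ^ (2 * H - 1) + (y - a) ^ (2 * H - 1)) := by
        refine intervalIntegral_mono_of_nonneg hab
          (fun y hy => intervalIntegral_nonneg_of_Ioc hab (hnn y hy)) (fun y hy => ?_) ?_
        · calc ∫ z in a..b, |y - z| ^ (2 * H - 2) * w y * w z
              ≤ ∫ z in a..b, M ^ 2 * |y - z| ^ (2 * H - 2) := by
                refine intervalIntegral_mono_of_nonneg hab (hnn y hy) (fun z hz => ?_)
                  ((intervalIntegrable_abs_sub_rpow hp hy.1.le hy.2).const_mul _)
                have h : w y * w z ≤ M ^ 2 := by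
                  rw [sq]
                  exact mul_le_mul (hw y hy) (hw z hz) (hw₀ z hz)
                    ((hw₀ y hy).trans (hw y hy))
                rw [mul_assoc, mul_comm]
                exact mul_le_mul_of_nonneg_right h (by positivity)
            _ = M ^ 2 / (2 * H - 1) * ((b - y) ^ (2 * H - 1) + (y - a) ^ (2 * H - 1)) := by
                rw [intervalIntegral.integral_const_mul,
                  integral_abs_sub_rpow hp hy.1.le hy.2, hpq]
                ring
        · exact (((hc.comp (continuous_const.sub continuous_id)).add
            (hc.comp (continuous_id.sub continuous_const))).intervalIntegrable _ _).const_mul _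
    _ = M ^ 2 / (H * (2 * H - 1)) * (b - a) ^ (2 * H) := by
        have h₁ : H ≠ 0 := by linarith
        have h₂ : 2 * H - 1 ≠ 0 := by linarith
        rw [intervalIntegral.integral_const_mul, integral_sub_rpow_add_sub_rpow hq,
          sub_add_cancel]
        field_simp

/-- Bound for the stochastic-integral term `I₃` in the proof of the local
linearization theorem, over (a parametrization of) the triangle `D₂`. -/
theorem I3_term_bound (H τ lam ε : ℝ) (hH₁ : 1/2 < H) (hH₂ : H < 1) (hε : 0 < ε) :
    (∫ s in ((τ + lam + ε)/Real.sqrt 2)..((τ + lam + ε)/Real.sqrt 2 + ε/Real.sqrt 2),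
      ∫ y in (s - Real.sqrt 2 * (τ + ε))..(-s + Real.sqrt 2 * (lam + ε)),
        ∫ z in (s - Real.sqrt 2 * (τ + ε))..(-s + Real.sqrt 2 * (lam + ε)),
          |y - z| ^ (2*H - 2) * (s + y - Real.sqrt 2 * lam) ^ H *
            (s + z - Real.sqrt 2 * lam) ^ H) ≤
      (2 : ℝ) ^ (2*H - 1/2) * ε ^ (4*H + 1) / ((2*H + 1) * H * (2*H - 1)) := by
  have hdiv : ∀ x : ℝ, x / Real.sqrt 2 = Real.sqrt 2 * x / 2 := fun x => by
    have h2 : Real.sqrt 2 * Real.sqrt 2 = 2 := Real.mul_self_sqrt (by norm_num)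
    rw [div_eq_div_iff (by positivity) (by norm_num)]
    linear_combination -x * h2
  rw [hdiv, hdiv]
  have hr : 0 < Real.sqrt 2 := by positivity
  have hrε : 0 < Real.sqrt 2 * ε := by positivity
  have hlen : ∀ s, -s + Real.sqrt 2 * (lam + ε) - (s - Real.sqrt 2 * (τ + ε)) =
      Real.sqrt 2 * (τ + lam + 2 * ε) - 2 * s := fun s => by ring
  have hc : Continuous fun x : ℝ => x ^ (2 * H) := Real.continuous_rpow_const (by linarith)
  have hIoc : ∀ s ∈ Set.Ioc (Real.sqrt 2 * (τ + lam + ε) / 2)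
      (Real.sqrt 2 * (τ + lam + ε) / 2 + Real.sqrt 2 * ε / 2),
      s - Real.sqrt 2 * (τ + ε) ≤ -s + Real.sqrt 2 * (lam + ε) := fun s hs => by
    linarith [hs.2]
  have hw₀ : ∀ s ∈ Set.Ioc (Real.sqrt 2 * (τ + lam + ε) / 2)
      (Real.sqrt 2 * (τ + lam + ε) / 2 + Real.sqrt 2 * ε / 2),
      ∀ y ∈ Set.Ioc (s - Real.sqrt 2 * (τ + ε)) (-s + Real.sqrt 2 * (lam + ε)),
      0 ≤ s + y - Real.sqrt 2 * lam := fun s hs y hy => by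
    linarith [hs.1, hy.1]
  calc _ ≤ ∫ s in (Real.sqrt 2 * (τ + lam + ε) / 2)..(Real.sqrt 2 * (τ + lam + ε) / 2 +
            Real.sqrt 2 * ε / 2), ((Real.sqrt 2 * ε) ^ H) ^ 2 / (H * (2 * H - 1)) *
          (Real.sqrt 2 * (τ + lam + 2 * ε) - 2 * s) ^ (2 * H) := by
        refine intervalIntegral_mono_of_nonneg (by linarith) (fun s hs => ?_) (fun s hs => ?_) ?_
        · refine intervalIntegral_nonneg_of_Ioc (hIoc s hs) fun y hy =>
            intervalIntegral_nonneg_of_Ioc (hIoc s hs) fun z hz => ?_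
          have h₁ := hw₀ s hs y hy
          have h₂ := hw₀ s hs z hz
          positivity
        · rw [← hlen]
          refine integral_integral_abs_sub_rpow_mul_le
            (w := fun y => (s + y - Real.sqrt 2 * lam) ^ H) hH₁ (hIoc s hs)
            (fun y hy => Real.rpow_nonneg (hw₀ s hs y hy) _)
            (fun y hy => Real.rpow_le_rpow (hw₀ s hs y hy) ?_ (by linarith))
          linarith [hy.2]
        · exact ((hc.comp (continuous_const.sub
            (continuous_const.mul continuous_id))).intervalIntegrable _ _).const_mul _
    _ = ((Real.sqrt 2 * ε) ^ H) ^ 2 / (H * (2 * H - 1)) *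
          (1 / 2 * ((Real.sqrt 2 * ε) ^ (2 * H + 1) / (2 * H + 1))) := by
        rw [intervalIntegral.integral_const_mul,
          intervalIntegral.integral_comp_sub_mul (fun x : ℝ => x ^ (2 * H)) two_ne_zero,
          integral_rpow (Or.inl (by linarith))]
        have h₁ : Real.sqrt 2 * (τ + lam + 2 * ε) -
            2 * (Real.sqrt 2 * (τ + lam + ε) / 2 + Real.sqrt 2 * ε / 2) = 0 := by ring
        have h₂ : Real.sqrt 2 * (τ + lam + 2 * ε) - 2 * (Real.sqrt 2 * (τ + lam + ε) / 2) =
            Real.sqrt 2 * ε := by ring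
        rw [h₁, h₂, Real.zero_rpow (by linarith), sub_zero, smul_eq_mul, one_div]
    _ = (2 : ℝ) ^ (2*H - 1/2) * ε ^ (4*H + 1) / ((2*H + 1) * H * (2*H - 1)) := by
        have h₁ : ((Real.sqrt 2 * ε) ^ H) ^ 2 * (Real.sqrt 2 * ε) ^ (2 * H + 1) =
            2 * ((2 : ℝ) ^ (2*H - 1/2) * ε ^ (4*H + 1)) := by
          rw [← Real.rpow_natCast, ← Real.rpow_mul hrε.le, ← Real.rpow_add hrε,
            Real.mul_rpow hr.le hε.le, Real.sqrt_eq_rpow, ← Real.rpow_mul zero_le_two,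
            ← mul_assoc, ← Real.rpow_one_add' zero_le_two (by linarith)]
          push_cast
          ring_nf
        have h₂ : (2 : ℝ) ^ (2*H - 1/2) * ε ^ (4*H + 1) =
            ((Real.sqrt 2 * ε) ^ H) ^ 2 * (Real.sqrt 2 * ε) ^ (2 * H + 1) / 2 := by
          linarith
        rw [h₂]
        have h₃ : H ≠ 0 := by linarith
        have h₄ : 2 * H - 1 ≠ 0 := by linarith
        have h₅ : 2 * H + 1 ≠ 0 := by linarith
        field_simp
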